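/- For fixed k, the number of isomorphism classes of n-vertex graphs of treewidth at most k is at most 2^{C·k·n} for some absolute constant C. -/

import Mathlib

variable {V : Type*}

/-- `(T, bags)` is a tree decomposition of `G`: `T` is a tree on the index type `I`, the bags
cover all vertices and edges of `G`, and for each vertex the set of bags containing it induces
a connected (hence subtree) part of `T`. -/
def IsTreeDecomp {I : Type*} (G : SimpleGraph V) (T : SimpleGraph I) (bags : I → Finset V) : Prop :=
  T.IsTree ∧
  (∀ v, ∃ i, v ∈ bags i) ∧
  (∀ v w, G.Adj v w → ∃ i, v ∈ bags i ∧ w ∈ bags i) ∧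
  (∀ v, (SimpleGraph.induce {i | v ∈ bags i} T).Connected)

/-- `G` has treewidth at most `k`: there is a tree decomposition of `G` of width at most `k`. -/
def TreewidthAtMost (G : SimpleGraph V) (k : ℕ) : Prop :=
  ∃ (m : ℕ) (T : SimpleGraph (Fin m)) (bags : Fin m → Finset V),
    IsTreeDecomp G T bags ∧ ∀ i, (bags i).card ≤ k + 1

section Aux

/-- A tree has a parent function and a depth function. -/
lemma aux_tree_parent {I : Type*} (T : SimpleGraph I) (hT : T.IsTree) :
    ∃ (par : I → I) (depth : I → ℕ),
      (∀ i, par i = i ∨ depth (par i) < depth i) ∧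
      (∀ x y, T.Adj x y → y = par x ∨ x = par y) := by
  classical
  obtain ⟨r⟩ := hT.1.nonempty
  choose P hP hPu using fun i => hT.existsUnique_path i r
  refine ⟨fun i => (P i).snd, fun i => (P i).length, ?_, ?_⟩
  · intro i
    by_cases hn : (P i).Nil
    · left
      have h0 : (P i).length = 0 := SimpleGraph.Walk.length_eq_zero_iff.mpr hn
      have : (P i).getVert 1 = r := SimpleGraph.Walk.getVert_of_length_le _ (by omega)
      have h2 := hn.eq
      exact this.trans h2.symm
    · right
      have h1 : (P i).tail = P (P i).snd := hPu _ _ (hP i).tail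
      have h2 := SimpleGraph.Walk.length_tail_add_one hn
      simp only
      rw [← h1]
      omega
  · intro x y hxy
    by_cases hy : y ∈ (P x).support
    · left
      exact hT.2.eq_snd_of_adj_start (hP x) hxy hy
    · right
      have h1 : SimpleGraph.Walk.cons hxy.symm (P x) = P y :=
        hPu _ _ ((hP x).cons hy)
      simp only
      rw [← h1]
      simp

lemma aux_desc {I : Type*} (T : SimpleGraph I) (par : I → I)
    (hadj : ∀ x y, T.Adj x y → y = par x ∨ x = par y)
    (C : Set I) (hC : (SimpleGraph.induce C T).Connected) (i : I) (hi : i ∈ C)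
    (hpi : par i ∉ C ∨ par i = i) : ∀ x ∈ C, ∃ a, par^[a] x = i := by
  intro x hx
  obtain ⟨w⟩ := hC.preconnected ⟨x, hx⟩ ⟨i, hi⟩
  have key : ∀ (u v : C), (SimpleGraph.induce C T).Walk u v → v.1 = i →
      ∃ a, par^[a] u.1 = i := by
    intro u v w
    induction w with
    | nil => intro h; exact ⟨0, h⟩
    | @cons u y v h p ih =>
      intro hv
      obtain ⟨a, ha⟩ := ih hv
      have hT : T.Adj u.1 y.1 := h
      rcases hadj _ _ hT with h1 | h1
      · refine ⟨a + 1, ?_⟩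
        rw [Function.iterate_succ_apply, ← h1, ha]
      · rcases a with _ | a
        · simp only [Function.iterate_zero, id] at ha
          rcases hpi with h2 | h2
          · exact absurd u.2 (by rw [h1, ha]; exact h2)
          · exact ⟨0, by simp [h1, ha, h2]⟩
        · refine ⟨a, ?_⟩
          rw [h1, ← Function.iterate_succ_apply, ha]
  exact key _ _ w rfl

/-- The perfect elimination structure obtained from a tree decomposition. -/
lemma aux_top {V I : Type*} (G : SimpleGraph V) (T : SimpleGraph I) (bags : I → Finset V)
    (h : IsTreeDecomp G T bags) :
    ∃ (t : V → I) (d : V → ℕ), (∀ v, v ∈ bags (t v)) ∧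
      ∀ u v i, d u ≤ d v → u ∈ bags i → v ∈ bags i → u ∈ bags (t v) := by
  classical
  obtain ⟨hT, hcov, -, hconn⟩ := h
  obtain ⟨par, depth, hdep, hadj⟩ := aux_tree_parent T hT
  have hmono : ∀ a i, depth (par^[a] i) ≤ depth i := by
    intro a
    induction a with
    | zero => intro i; simp
    | succ a ih =>
      intro i
      rw [Function.iterate_succ_apply]
      refine (ih _).trans ?_
      rcases hdep i with h | h
      · rw [h]
      · exact h.le
  have hex : ∀ v, ∃ t, v ∈ bags t ∧ ∀ x, v ∈ bags x → ∃ a, par^[a] x = t := by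
    intro v
    have hne : ∃ m, ∃ i, v ∈ bags i ∧ depth i = m := by
      obtain ⟨i, hi⟩ := hcov v
      exact ⟨_, i, hi, rfl⟩
    obtain ⟨i, hi, hm⟩ := Nat.find_spec hne
    have hmin : ∀ j, v ∈ bags j → depth i ≤ depth j := by
      intro j hj
      rw [hm]
      exact Nat.find_min' hne ⟨j, hj, rfl⟩
    refine ⟨i, hi, aux_desc T par hadj {i | v ∈ bags i} (hconn v) i hi ?_⟩
    rcases hdep i with h | h
    · exact Or.inr h
    · left
      intro h2
      have := hmin _ h2
      omega
  choose t ht htd using hex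
  refine ⟨t, fun v => depth (t v), ht, ?_⟩
  intro u v i hd hu hv
  obtain ⟨b, hb⟩ := htd v i hv
  have : ∀ b', b' ≤ b → u ∈ bags (par^[b'] i) := by
    intro b'
    induction b' with
    | zero => intro _; exact hu
    | succ c ih =>
      intro hc
      have hx := ih (by omega)
      by_contra hcon
      rw [Function.iterate_succ_apply'] at hcon
      obtain ⟨a, ha⟩ := aux_desc T par hadj {i | u ∈ bags i} (hconn u) _ hx (Or.inl hcon)
        (t u) (ht u)
      have h1 : depth (par^[c] i) ≤ depth (t u) := by rw [← ha]; exact hmono _ _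
      have h2 : depth (par (par^[c] i)) < depth (par^[c] i) := by
        rcases hdep (par^[c] i) with h | h
        · rw [h] at hcon; exact absurd hx hcon
        · exact h
      have h3 : depth (t v) ≤ depth (par (par^[c] i)) := by
        rw [← hb]
        obtain ⟨e, rfl⟩ := Nat.exists_eq_add_of_le hc
        rw [← Function.iterate_succ_apply' par, Nat.add_comm, Function.iterate_add_apply]
        exact hmono _ _
      simp only at hd
      omega
  have := this b le_rfl
  rwa [hb] at this

/-- Greedy colouring along an ordering. -/
lemma aux_color {V : Type*} [DecidableEq V] (k : ℕ) (ord : V → ℕ)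
    (hord : Function.Injective ord) (N : V → Finset V)
    (hN : ∀ v, ∀ u ∈ N v, ord u < ord v) (hk : ∀ v, (N v).card ≤ k) (M : ℕ) :
    ∃ c : V → Fin (k + 1), ∀ v, ord v < M → ∀ u ∈ N v, c u ≠ c v := by
  induction M with
  | zero => exact ⟨fun _ => 0, fun v hv => absurd hv (by omega)⟩
  | succ M ih =>
    obtain ⟨c, hc⟩ := ih
    by_cases hex : ∃ w, ord w = M
    · obtain ⟨w, hw⟩ := hex
      have hcol : ∃ j : Fin (k + 1), j ∉ (N w).image c := by
        by_contra hcon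
        push Not at hcon
        have h1 : (N w).image c = Finset.univ := Finset.eq_univ_iff_forall.mpr hcon
        have h2 : ((N w).image c).card = k + 1 := by rw [h1]; simp
        have h3 : ((N w).image c).card ≤ (N w).card := Finset.card_image_le
        have := hk w
        omega
      obtain ⟨j, hj⟩ := hcol
      refine ⟨Function.update c w j, ?_⟩
      intro v hv u hu
      have huv := hN v u hu
      have huw : u ≠ w := by rintro rfl; omega
      rw [Function.update_of_ne huw]
      by_cases hvw : v = w
      · subst hvw
        rw [Function.update_self]
        rintro rfl
        exact hj (Finset.mem_image_of_mem c hu)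
      · rw [Function.update_of_ne hvw]
        refine hc v ?_ u hu
        have : ord v ≠ M := fun h => hvw (hord (h.trans hw.symm))
        omega
    · refine ⟨c, fun v hv u hu => hc v ?_ u hu⟩
      have : ord v ≠ M := fun h => hex ⟨v, h⟩
      omega

/-- The relation decoded from a parent function, a colouring and colour sets: `u` is the nearest
proper ancestor of `v` of its colour, and its colour belongs to the set of `v`. -/
def auxRel {V K : Type*} (p : V → V) (c : V → K) (S : V → Finset K) (v u : V) : Prop :=
  ∃ a, u = p^[a + 1] v ∧ (∀ b < a, c (p^[b + 1] v) ≠ c u) ∧ c u ∈ S v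

/-- The decoded graph. -/
def auxGraph {V K : Type*} (p : V → V) (c : V → K) (S : V → Finset K) : SimpleGraph V :=
  SimpleGraph.fromRel (auxRel p c S)

/-- Every graph of bounded treewidth is decoded from some data. -/
lemma aux_encode (k n : ℕ) (hn : 0 < n) (G : SimpleGraph (Fin n)) (hG : TreewidthAtMost G k) :
    ∃ (ord : Fin n → ℕ) (r : Fin n) (p : Fin n → Fin n) (c : Fin n → Fin (k + 1))
      (S : Fin n → Finset (Fin (k + 1))),
      p r = r ∧ (∀ v, v ≠ r → ord (p v) < ord v) ∧ G = auxGraph p c S := by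
  classical
  obtain ⟨m, T, bags, hdec, hcard⟩ := hG
  obtain ⟨t, d, ht, hK⟩ := aux_top G T bags hdec
  have hedge := hdec.2.2.1
  let ord : Fin n → ℕ := fun v => n * d v + v.1
  have hdiv : ∀ v, ord v / n = d v := by
    intro v
    simp only [ord]
    rw [Nat.mul_add_div hn, Nat.div_eq_of_lt v.2, Nat.add_zero]
  have hmod : ∀ v, ord v % n = v.1 := by
    intro v
    simp only [ord]
    rw [Nat.mul_add_mod, Nat.mod_eq_of_lt v.2]
  have hinj : Function.Injective ord := by
    intro u v h
    apply Fin.ext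
    rw [← hmod u, ← hmod v, h]
  have hd : ∀ u v, ord u ≤ ord v → d u ≤ d v := by
    intro u v h
    rw [← hdiv u, ← hdiv v]
    exact Nat.div_le_div_right h
  let N : Fin n → Finset (Fin n) := fun v => (bags (t v)).filter (fun u => ord u < ord v)
  have hNlt : ∀ v, ∀ u ∈ N v, ord u < ord v := fun v u hu => (Finset.mem_filter.mp hu).2
  have hNmem : ∀ u v i, ord u < ord v → u ∈ bags i → v ∈ bags i → u ∈ N v := by
    intro u v i h hu hv
    exact Finset.mem_filter.mpr ⟨hK u v i (hd u v h.le) hu hv, h⟩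
  have hNcard : ∀ v, (N v).card ≤ k := by
    intro v
    have h1 : N v ⊆ (bags (t v)).erase v := by
      intro u hu
      refine Finset.mem_erase.mpr ⟨?_, (Finset.mem_filter.mp hu).1⟩
      rintro rfl
      exact lt_irrefl _ (hNlt _ _ hu)
    have h2 := Finset.card_le_card h1
    rw [Finset.card_erase_of_mem (ht v)] at h2
    have := hcard (t v)
    omega
  obtain ⟨c0, hc0⟩ := aux_color k ord hinj N hNlt hNcard (n * (Finset.univ.sup d) + n)
  have hc : ∀ v, ∀ u ∈ N v, c0 u ≠ c0 v := by
    intro v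
    apply hc0
    simp only [ord]
    have : d v ≤ Finset.univ.sup d := Finset.le_sup (Finset.mem_univ v)
    have := Nat.mul_le_mul_left n this
    have := v.2
    omega
  obtain ⟨r, -, hr⟩ := Finset.exists_min_image Finset.univ ord ⟨⟨0, hn⟩, Finset.mem_univ _⟩
  have hp : ∀ v, ∃ q, (v = r → q = r) ∧ (v ≠ r → ord q < ord v) ∧
      ∀ u ∈ N v, u = q ∨ u ∈ N q := by
    intro v
    by_cases hne : (N v).Nonempty
    · obtain ⟨q, hq, hmax⟩ := Finset.exists_max_image (N v) ord hne
      refine ⟨q, ?_, fun _ => hNlt v q hq, ?_⟩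
      · rintro rfl
        have := hr q (Finset.mem_univ _)
        have := hNlt _ _ hq
        omega
      · intro u hu
        by_cases huq : u = q
        · exact Or.inl huq
        · right
          have h1 := hmax u hu
          have h2 : ord u ≠ ord q := fun h => huq (hinj h)
          exact hNmem u q (t v) (by omega) (Finset.mem_filter.mp hu).1 (Finset.mem_filter.mp hq).1
    · refine ⟨r, fun _ => rfl, ?_, fun u hu => absurd ⟨u, hu⟩ hne⟩
      intro hv
      have h1 := hr v (Finset.mem_univ _)
      have h2 : ord r ≠ ord v := fun h => hv (hinj h).symm
      omega
  choose p hpr hplt hpN using hp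
  let S : Fin n → Finset (Fin (k + 1)) := fun v =>
    ((N v).filter (fun u => G.Adj v u)).image c0
  refine ⟨ord, r, p, c0, S, hpr r rfl, hplt, ?_⟩
  -- every element of `N v` is the nearest ancestor of its colour
  have hnear : ∀ M v, ord v < M → ∀ u ∈ N v, ∃ a, u = p^[a + 1] v ∧
      ∀ b < a, c0 (p^[b + 1] v) ≠ c0 u := by
    intro M
    induction M with
    | zero => intro v hv; exact absurd hv (by omega)
    | succ M ih =>
      intro v hv u hu
      rcases hpN v u hu with h | h
      · exact ⟨0, h, fun b hb => absurd hb (by omega)⟩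
      · have hvr : v ≠ r := by
          rintro rfl
          have := hr u (Finset.mem_univ _)
          have := hNlt _ _ hu
          omega
        have := hplt v hvr
        obtain ⟨a, ha, hb⟩ := ih (p v) (by omega) u h
        refine ⟨a + 1, ?_, ?_⟩
        · rw [Function.iterate_succ_apply]; exact ha
        · intro b hba
          rw [Function.iterate_succ_apply]
          rcases b with _ | b
          · exact (hc _ _ h).symm
          · exact hb b (by omega)
  have hfwd : ∀ v u, G.Adj v u → ord u < ord v → auxRel p c0 S v u := by
    intro v u hvu hlt
    obtain ⟨i, hv, hu⟩ := hedge v u hvu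
    have hu' := hNmem u v i hlt hu hv
    obtain ⟨a, ha, hb⟩ := hnear _ v (Nat.lt_succ_self _) u hu'
    exact ⟨a, ha, hb, Finset.mem_image_of_mem _ (Finset.mem_filter.mpr ⟨hu', hvu⟩)⟩
  have hbwd : ∀ v u, auxRel p c0 S v u → G.Adj v u := by
    rintro v u ⟨a, ha, hb, hS⟩
    obtain ⟨u', hu', hcu⟩ := Finset.mem_image.mp hS
    obtain ⟨hu', hadj⟩ := Finset.mem_filter.mp hu'
    obtain ⟨a', ha', hb'⟩ := hnear _ v (Nat.lt_succ_self _) u' hu'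
    have : a = a' := by
      rcases lt_trichotomy a a' with h | h | h
      · exact absurd (by rw [← ha, hcu]) (hb' a h)
      · exact h
      · exact absurd (by rw [← ha', hcu]) (hb a' h)
    subst this
    rw [ha, ← ha']
    exact hadj
  ext v u
  rw [auxGraph, SimpleGraph.fromRel_adj]
  constructor
  · intro h
    refine ⟨h.ne, ?_⟩
    rcases lt_trichotomy (ord u) (ord v) with h1 | h1 | h1
    · exact Or.inl (hfwd v u h h1)
    · exact absurd (hinj h1) h.ne.symm
    · exact Or.inr (hfwd u v h.symm h1)
  · rintro ⟨-, h | h⟩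
    · exact hbwd v u h
    · exact (hbwd u v h).symm

/-- Breadth-first relabelling: a parent function can be made monotone. -/
lemma aux_mono (n : ℕ) (ord : Fin n → ℕ) (r : Fin n) (p : Fin n → Fin n) (hpr : p r = r)
    (hp : ∀ v, v ≠ r → ord (p v) < ord v) :
    ∃ σ : Equiv.Perm (Fin n), Monotone (fun i => σ.symm (p (σ i))) := by
  classical
  have hkey : ∀ M, ∃ key : Fin n → ℕ, key r = 0 ∧
      ∀ v, ord v < M → v ≠ r → key v = (n + 1) * key (p v) + (v.1 + 1) := by
    intro M
    induction M with
    | zero => exact ⟨fun _ => 0, rfl, fun v hv => absurd hv (by omega)⟩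
    | succ M ih =>
      obtain ⟨key, h0, h1⟩ := ih
      refine ⟨fun v => if v = r then 0 else if ord v < M then key v
        else (n + 1) * key (p v) + (v.1 + 1), by simp, ?_⟩
      intro v hv hvr
      have h2 := hp v hvr
      have h3 : ord (p v) < M := by omega
      have h4 : (if p v = r then 0 else if ord (p v) < M then key (p v)
        else (n + 1) * key (p (p v)) + ((p v).1 + 1)) = key (p v) := by
        by_cases h5 : p v = r
        · rw [if_pos h5, h5, h0]
        · rw [if_neg h5, if_pos h3]
      simp only
      rw [h4, if_neg hvr]
      split_ifs with h6
      · exact h1 v h6 hvr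
      · rfl
  obtain ⟨key, h0, h1⟩ := hkey (Finset.univ.sup ord + 1)
  have h2 : ∀ v, v ≠ r → key v = (n + 1) * key (p v) + (v.1 + 1) := by
    intro v
    apply h1
    exact Nat.lt_succ_of_le (Finset.le_sup (Finset.mem_univ v))
  have hdiv : ∀ v, key v / (n + 1) = key (p v) := by
    intro v
    by_cases hv : v = r
    · subst hv; rw [hpr, h0]; simp
    · rw [h2 v hv, Nat.mul_add_div (by omega), Nat.div_eq_of_lt (by omega), Nat.add_zero]
  have hmod : ∀ v, key v % (n + 1) = if v = r then 0 else v.1 + 1 := by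
    intro v
    by_cases hv : v = r
    · rw [if_pos hv, hv, h0]; simp
    · rw [if_neg hv, h2 v hv, Nat.mul_add_mod, Nat.mod_eq_of_lt (by omega)]
  have hinj : Function.Injective key := by
    intro u v h
    have h3 := hmod u
    rw [h, hmod v] at h3
    split_ifs at h3 with h4 h5 h5
    · rw [h4, h5]
    · apply Fin.ext; omega
  have hs : StrictMono (key ∘ Tuple.sort key) :=
    (Tuple.monotone_sort key).strictMono_of_injective (hinj.comp (Tuple.sort key).injective)
  refine ⟨Tuple.sort key, ?_⟩
  intro i j hij
  rw [← hs.le_iff_le]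
  simp only [Function.comp, Equiv.apply_symm_apply]
  rw [← hdiv, ← hdiv]
  exact Nat.div_le_div_right (hs.monotone hij)

/-- There are at most `2 ^ (2 * n)` monotone self-maps of `Fin n`. -/
lemma aux_card_mono (n : ℕ) [DecidablePred fun f : Fin n → Fin n => Monotone f] :
    (Finset.univ.filter (fun f : Fin n → Fin n => Monotone f)).card ≤ 2 ^ (2 * n) := by
  classical
  let g : (Fin n → Fin n) → Fin n → Fin (2 * n) := fun f i => ⟨i.1 + (f i).1, by omega⟩
  have hg : ∀ f, Monotone f → StrictMono (g f) := by
    intro f hf i j hij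
    have h1 : (f i).1 ≤ (f j).1 := hf hij.le
    have h2 : i.1 < j.1 := hij
    simp only [g, Fin.lt_def]
    omega
  have : (Finset.univ.filter (fun f : Fin n → Fin n => Monotone f)).card ≤
      (Finset.univ : Finset (Finset (Fin (2 * n)))).card := by
    apply Finset.card_le_card_of_injOn (fun f => Finset.univ.image (g f))
    · intro f _; simp
    · intro f hf f' hf' h
      have hf := hg f (Finset.mem_filter.mp hf).2
      have hf' := hg f' (Finset.mem_filter.mp hf').2
      simp only at h
      have hc : (Finset.univ.image (g f)).card = n := by
        rw [Finset.card_image_of_injective _ hf.injective]; simp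
      have e1 := Finset.orderEmbOfFin_unique hc (f := g f) (by intro x; simp) hf
      have e2 := Finset.orderEmbOfFin_unique hc (f := g f') (by intro x; rw [h]; simp) hf'
      funext i
      have e3 : g f i = g f' i := by rw [e1, e2]
      simp only [g, Fin.mk.injEq] at e3
      apply Fin.ext
      omega
  simpa using this

lemma aux_iso {V K : Type*} (p : V → V) (c : V → K) (S : V → Finset K) (σ : Equiv.Perm V) :
    Nonempty (auxGraph p c S ≃g
      auxGraph (fun i => σ.symm (p (σ i))) (fun i => c (σ i)) (fun i => S (σ i))) := by
  have hit : ∀ a v, (fun i => σ.symm (p (σ i)))^[a] v = σ.symm (p^[a] (σ v)) := by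
    intro a
    induction a with
    | zero => intro v; simp
    | succ a ih => intro v; rw [Function.iterate_succ_apply, ih, Function.iterate_succ_apply]; simp
  have hrel : ∀ u v, auxRel (fun i => σ.symm (p (σ i))) (fun i => c (σ i)) (fun i => S (σ i)) u v
      ↔ auxRel p c S (σ u) (σ v) := by
    intro u v
    unfold auxRel
    simp only [hit, Equiv.apply_symm_apply, Equiv.eq_symm_apply]
  refine ⟨⟨σ.symm, ?_⟩⟩
  intro a b
  simp [auxGraph, SimpleGraph.fromRel_adj, hrel]

end Aux

/-- There is an absolute constant `C` such that for all `k` and `n`, the number of isomorphism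
classes of `n`-vertex graphs of treewidth at most `k` is at most `2 ^ (C * k * n)`: there is a
set of at most `2 ^ (C * k * n)` graphs on `Fin n` such that every graph on `Fin n` of
treewidth at most `k` is isomorphic to one of them. -/
theorem count_isoclasses_of_bounded_treewidth :
    ∃ C : ℕ, ∀ k n : ℕ, ∃ R : Finset (SimpleGraph (Fin n)),
      R.card ≤ 2 ^ (C * k * n) ∧
      ∀ G : SimpleGraph (Fin n), TreewidthAtMost G k →
        ∃ H ∈ R, Nonempty (G ≃g H) := by
  classical
  refine ⟨5, fun k n => ?_⟩
  rcases Nat.eq_zero_or_pos n with rfl | hn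
  · refine ⟨{⊥}, by simp, fun G _ => ⟨⊥, by simp, ?_⟩⟩
    rw [Subsingleton.elim G ⊥]
    exact ⟨SimpleGraph.Iso.refl⟩
  rcases Nat.eq_zero_or_pos k with rfl | hk
  · refine ⟨{⊥}, by simp, fun G hG => ⟨⊥, by simp, ?_⟩⟩
    have : G = ⊥ := by
      obtain ⟨m, T, bags, hdec, hcard⟩ := hG
      ext u v
      simp only [SimpleGraph.bot_adj, iff_false]
      intro huv
      obtain ⟨i, hu, hv⟩ := hdec.2.2.1 u v huv
      exact huv.ne (Finset.card_le_one.mp (hcard i) u hu v hv)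
    rw [this]
    exact ⟨SimpleGraph.Iso.refl⟩
  · let D : Finset ((Fin n → Fin n) × (Fin n → Fin (k + 1)) × (Fin n → Finset (Fin (k + 1)))) :=
      (Finset.univ.filter (fun f : Fin n → Fin n => Monotone f)) ×ˢ Finset.univ
    refine ⟨D.image (fun x => auxGraph x.1 x.2.1 x.2.2), ?_, ?_⟩
    · refine Finset.card_image_le.trans ?_
      have h1 := aux_card_mono n
      have h2 : D.card = (Finset.univ.filter (fun f : Fin n → Fin n => Monotone f)).card *
          ((k + 1) ^ n * (2 ^ (k + 1)) ^ n) := by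
        simp [D, Finset.card_product]
      have h3 : (k + 1) ^ n ≤ (2 ^ k) ^ n := Nat.pow_le_pow_left Nat.lt_two_pow_self n
      rw [h2]
      calc _ ≤ 2 ^ (2 * n) * ((2 ^ k) ^ n * (2 ^ (k + 1)) ^ n) := by gcongr
        _ = 2 ^ (2 * n + (k * n + (k + 1) * n)) := by
          rw [← pow_mul, ← pow_mul, ← pow_add, ← pow_add]
        _ ≤ 2 ^ (5 * k * n) := by
          apply Nat.pow_le_pow_right (by norm_num)
          nlinarith
    · intro G hG
      obtain ⟨ord, r, p, c, S, hpr, hp, rfl⟩ := aux_encode k n hn G hG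
      obtain ⟨σ, hσ⟩ := aux_mono n ord r p hpr hp
      refine ⟨_, Finset.mem_image.mpr ⟨(fun i => σ.symm (p (σ i)), fun i => c (σ i),
        fun i => S (σ i)), ?_, rfl⟩, aux_iso p c S σ⟩
      simp [D, hσ]
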